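/- (Upward Convergence Theorem) Let (f_n) be a nondecreasing sequence of extended real variables on the path space Ω, uniformly bounded below (f_n ≥ M for some real M and all n), converging pointwise to an extended real variable f. If E_V(f) < +∞, then E_V(f) = lim_n E_V(f_n). -/

import Mathlib

open Filter

/-- prefix of length `n` of a path -/
def pref {X : Type*} (ω : ℕ → X) (n : ℕ) : List X := (List.range n).map ω

/-- process difference -/
def pdiff {X : Type*} (M : List X → ℝ) (s : List X) : X → ℝ := fun x => M (s ++ [x]) - M s

/-- process multiplier -/
noncomputable def pmul {X : Type*} (M : List X → ℝ) (s : List X) : X → ℝ :=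
  fun x => M (s ++ [x]) / M s

/-- family of coherent upper expectations (local models of an imprecise probability tree) -/
def Coherent {X : Type*} (Q : List X → (X → ℝ) → ℝ) : Prop :=
  ∀ s : List X,
    (∀ h : X → ℝ, Q s h ≤ ⨆ x, h x) ∧
    (∀ h g : X → ℝ, Q s (h + g) ≤ Q s h + Q s g) ∧
    (∀ (h : X → ℝ) (c : ℝ), 0 ≤ c → Q s (c • h) = c * Q s h)

/-- supermartingale for the tree with local models `Q` -/
def IsSupermart {X : Type*} (Q : List X → (X → ℝ) → ℝ) (M : List X → ℝ) : Prop :=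
  ∀ s : List X, Q s (pdiff M s) ≤ 0

/-- bounded below process -/
def BddBelowProc {X : Type*} (M : List X → ℝ) : Prop := ∃ C : ℝ, ∀ s : List X, C ≤ M s

/-- test supermartingale: nonnegative supermartingale with initial value 1 -/
def IsTestSupermart {X : Type*} (Q : List X → (X → ℝ) → ℝ) (M : List X → ℝ) : Prop :=
  IsSupermart Q M ∧ (∀ s : List X, 0 ≤ M s) ∧ M [] = 1

/-- game-theoretic upper expectation conditional on a situation `s` -/
noncomputable def EV {X : Type*} (Q : List X → (X → ℝ) → ℝ) (f : (ℕ → X) → EReal)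
    (s : List X) : EReal :=
  sInf { y : EReal | ∃ M : List X → ℝ, IsSupermart Q M ∧ BddBelowProc M ∧
    (∀ ω : ℕ → X, pref ω s.length = s →
      f ω ≤ Filter.liminf (fun n => ((M (pref ω n) : ℝ) : EReal)) Filter.atTop) ∧
    y = ((M s : ℝ) : EReal) }



theorem Q_approx {X : Type*} [Fintype X] [Nonempty X]
    {Q : List X → (X → ℝ) → ℝ} (hQ : Coherent Q) (s : List X) (h g : X → ℝ) (d : ℝ)
    (H : ∀ x, h x ≤ g x + d) : Q s h ≤ Q s g + d := by
  have h1 : h = g + (h - g) := by simp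
  have h2 := (hQ s).2.1 g (h - g)
  rw [← h1] at h2
  have h3 := (hQ s).1 (h - g)
  have h4 : (⨆ x, (h - g) x) ≤ d := ciSup_le fun x => by
    have := H x
    simp only [Pi.sub_apply]; linarith
  linarith

theorem supermart_of_approx {X : Type*} [Fintype X] [Nonempty X]
    {Q : List X → (X → ℝ) → ℝ} (hQ : Coherent Q) (s : List X) (N : List X → ℝ)
    (H : ∀ ε > 0, ∃ M, IsSupermart Q M ∧ ∀ x, pdiff N s x ≤ pdiff M s x + ε) :
    Q s (pdiff N s) ≤ 0 := by
  refine le_of_forall_pos_le_add fun ε hε => ?_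
  obtain ⟨M, hM, h⟩ := H ε hε
  have := Q_approx hQ s _ _ ε h
  have := hM s
  linarith

theorem supermart_of_limit {X : Type*} [Fintype X] [Nonempty X]
    {Q : List X → (X → ℝ) → ℝ} (hQ : Coherent Q) (N : List X → ℝ) (M : ℕ → List X → ℝ)
    (hM : ∀ n, IsSupermart Q (M n)) (hl : ∀ s, Tendsto (fun n => M n s) atTop (nhds (N s))) :
    IsSupermart Q N := by
  intro s
  refine supermart_of_approx hQ s N fun ε hε => ?_
  have h1 : ∀ x, ∀ᶠ n in atTop, pdiff N s x ≤ pdiff (M n) s x + ε := by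
    intro x
    have h2 : Tendsto (fun n => pdiff (M n) s x + ε) atTop (nhds (pdiff N s x + ε)) :=
      ((hl _).sub (hl _)).add_const ε
    exact (h2.eventually_const_lt (by linarith)).mono fun n h => h.le
  obtain ⟨n, hn⟩ := (eventually_all.2 h1).exists
  exact ⟨M n, hM n, hn⟩

theorem Q_zero {X : Type*}
    {Q : List X → (X → ℝ) → ℝ} (hQ : Coherent Q) (s : List X) : Q s 0 = 0 := by
  have := (hQ s).2.2 0 0 le_rfl
  simpa using this

theorem supermart_zero {X : Type*}
    {Q : List X → (X → ℝ) → ℝ} (hQ : Coherent Q) : IsSupermart Q (fun _ => 0) := by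
  intro s
  have : pdiff (fun _ : List X => (0:ℝ)) s = 0 := by ext; simp [pdiff]
  rw [this, Q_zero hQ]

theorem supermart_add_const {X : Type*}
    {Q : List X → (X → ℝ) → ℝ} {M : List X → ℝ} (hM : IsSupermart Q M) (c : ℝ) :
    IsSupermart Q (fun s => M s + c) := by
  intro s
  have : pdiff (fun s => M s + c) s = pdiff M s := by ext; simp [pdiff]
  rw [this]; exact hM s

theorem supermart_add {X : Type*}
    {Q : List X → (X → ℝ) → ℝ} (hQ : Coherent Q) {M N : List X → ℝ} (hM : IsSupermart Q M)
    (hN : IsSupermart Q N) :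
    IsSupermart Q (fun s => M s + N s) := by
  intro s
  have : pdiff (fun s => M s + N s) s = pdiff M s + pdiff N s := by ext; simp [pdiff]; ring
  rw [this]; linarith [hM s, hN s, (hQ s).2.1 (pdiff M s) (pdiff N s)]

theorem supermart_mul {X : Type*}
    {Q : List X → (X → ℝ) → ℝ} (hQ : Coherent Q) {M : List X → ℝ} (hM : IsSupermart Q M)
    (c : ℝ) (hc : 0 ≤ c) :
    IsSupermart Q (fun s => c * M s) := by
  intro s
  have : pdiff (fun s => c * M s) s = c • pdiff M s := by ext; simp [pdiff]; ring
  rw [this, (hQ s).2.2 _ _ hc]; exact mul_nonpos_of_nonneg_of_nonpos hc (hM s)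

theorem pref_succ {X : Type*} (ω : ℕ → X) (n : ℕ) : pref ω (n+1) = pref ω n ++ [ω n] := by
  simp [pref, List.range_succ]

theorem pref_length {X : Type*} (ω : ℕ → X) (n : ℕ) : (pref ω n).length = n := by
  simp [pref]

theorem pref_take {X : Type*} (ω : ℕ → X) {m n : ℕ} (h : m ≤ n) :
    (pref ω n).take m = pref ω m := by
  simp [pref, ← List.map_take, List.take_range, h]

theorem pref_through {X : Type*} (ω : ℕ → X) {s t : List X}
    (h : pref ω (s ++ t).length = s ++ t) : pref ω s.length = s := by
  rw [← pref_take ω (by simp : s.length ≤ (s++t).length), h]; simp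

theorem exists_path {X : Type*} (c : List X → X) (t : List X) :
    ∃ ω : ℕ → X, pref ω t.length = t ∧ ∀ n, t.length ≤ n → ω n = c (pref ω n) := by
  classical
  let d : ℕ → List X → X := fun n u => if h : n < t.length then t[n] else c u
  let u : ℕ → List X := fun n => Nat.rec [] (fun n l => l ++ [d n l]) n
  let ω : ℕ → X := fun n => d n (u n)
  have hu : ∀ n, pref ω n = u n := by
    intro n
    induction n with
    | zero => rfl
    | succ n ih => rw [pref_succ, ih]
  refine ⟨ω, ?_, ?_⟩
  · apply List.ext_getElem
    · simp [pref]
    · intro i h1 h2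
      simp [pref, ω, d, h2]
  · intro n hn
    rw [hu]
    simp [ω, d, not_lt.2 hn]

theorem exists_le {X : Type*} [Fintype X] [Nonempty X]
    {Q : List X → (X → ℝ) → ℝ} (hQ : Coherent Q) {M : List X → ℝ} (hM : IsSupermart Q M)
    (s : List X) : ∃ x, M (s ++ [x]) ≤ M s := by
  by_contra! hc
  obtain ⟨x0, h0⟩ := Finite.exists_min (fun x => M (s ++ [x]))
  have h1 := Q_approx hQ s 0 (pdiff M s) (-(M (s ++ [x0]) - M s)) (by
    intro x; simp only [pdiff, Pi.zero_apply]; linarith [h0 x])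
  rw [Q_zero hQ] at h1
  linarith [hM s, hc x0]

theorem lower_bound {X : Type*} [Fintype X] [Nonempty X]
    {Q : List X → (X → ℝ) → ℝ} (hQ : Coherent Q) {M : List X → ℝ} (hM : IsSupermart Q M)
    {g : (ℕ → X) → EReal} {c : ℝ} (hg : ∀ ω, (c : EReal) ≤ g ω) (s : List X)
    (h : ∀ ω : ℕ → X, pref ω s.length = s →
      g ω ≤ Filter.liminf (fun n => ((M (pref ω n) : ℝ) : EReal)) Filter.atTop) (t : List X) :
    c ≤ M (s ++ t) := by
  choose d hd using exists_le hQ hM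
  obtain ⟨ω, h1, h2⟩ := exists_path d (s ++ t)
  have h3 := (hg ω).trans (h ω (pref_through ω h1))
  have h4 : ∀ n, (s++t).length ≤ n → M (pref ω n) ≤ M (s ++ t) := by
    intro n hn
    induction n, hn using Nat.le_induction with
    | base => rw [h1]
    | succ n hn ih => rw [pref_succ, h2 n hn]; exact (hd _).trans ih
  have h5 : Filter.liminf (fun n => ((M (pref ω n) : ℝ) : EReal)) Filter.atTop
      ≤ ((M (s ++ t) : ℝ) : EReal) := by
    refine liminf_le_of_frequently_le' (Eventually.frequently ?_)
    filter_upwards [eventually_ge_atTop (s++t).length] with n hn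
    exact_mod_cast h4 n hn
  exact_mod_cast h3.trans h5

/-- `N` is null: some nonnegative supermartingale tends to infinity on it. -/
def NullSet {X : Type*} (Q : List X → (X → ℝ) → ℝ) (N : Set (ℕ → X)) : Prop :=
  ∃ T : List X → ℝ, IsSupermart Q T ∧ (∀ s, 0 ≤ T s) ∧
    ∀ ω ∈ N, Tendsto (fun n => T (pref ω n)) atTop atTop

theorem null_union {X : Type*} [Fintype X] [Nonempty X]
    {Q : List X → (X → ℝ) → ℝ} (hQ : Coherent Q) (N : ℕ → Set (ℕ → X))
    (hN : ∀ i, NullSet Q (N i)) : NullSet Q (⋃ i, N i) := by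
  choose T hT h0 hl using hN
  have hB : ∀ i, ∃ B : ℝ, 0 < B ∧ ∀ s : List X, s.length ≤ i → T i s ≤ B := by
    intro i
    have hfin : {s : List X | s.length ≤ i}.Finite := List.finite_length_le X i
    obtain ⟨B, hB⟩ := (hfin.image (T i)).bddAbove
    refine ⟨max B 1, by positivity, fun s hs => le_max_of_le_left (hB ⟨s, hs, rfl⟩)⟩
  choose B hB0 hB using hB
  let w : ℕ → ℝ := fun i => (1/2)^i / B i
  have hw : ∀ i, 0 < w i := fun i => by have := hB0 i; positivity
  have hterm : ∀ i s, 0 ≤ w i * T i s := fun i s => mul_nonneg (hw i).le (h0 i s)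
  have hsum : ∀ s, Summable (fun i => w i * T i s) := by
    intro s
    rw [← summable_nat_add_iff s.length]
    refine Summable.of_nonneg_of_le (fun i => hterm _ _) (fun i => ?_)
      ((summable_nat_add_iff s.length).2 summable_geometric_two)
    have h1 := hB (i + s.length) s (by omega)
    have h2 := hB0 (i + s.length)
    simp only [w]
    rw [div_mul_eq_mul_div, div_le_iff₀ h2]
    gcongr
  refine ⟨fun s => ∑' i, w i * T i s, ?_, fun s => tsum_nonneg fun i => hterm i s, ?_⟩
  · refine supermart_of_limit hQ _ (fun n s => ∑ i ∈ Finset.range n, w i * T i s) ?_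
      fun s => (hsum s).hasSum.tendsto_sum_nat
    intro n
    induction n with
    | zero => simpa using supermart_zero hQ
    | succ n ih =>
      simp only [Finset.sum_range_succ]
      exact supermart_add hQ ih (supermart_mul hQ (hT n) _ (hw n).le)
  · intro ω hω
    obtain ⟨i, hi⟩ := Set.mem_iUnion.1 hω
    refine tendsto_atTop_mono (fun n => ?_) ((hl i ω hi).const_mul_atTop (hw i))
    exact (hsum _).le_tsum i fun j _ => hterm j _

theorem EV_exists {X : Type*} {Q : List X → (X → ℝ) → ℝ} {g : (ℕ → X) → EReal} {s : List X}
    {a : ℝ} (h : EV Q g s < a) : ∃ M : List X → ℝ, IsSupermart Q M ∧ BddBelowProc M ∧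
    (∀ ω : ℕ → X, pref ω s.length = s →
      g ω ≤ Filter.liminf (fun n => ((M (pref ω n) : ℝ) : EReal)) Filter.atTop) ∧ M s < a := by
  obtain ⟨y, ⟨M, h1, h2, h3, rfl⟩, h4⟩ := sInf_lt_iff.1 h
  exact ⟨M, h1, h2, h3, by exact_mod_cast h4⟩

theorem EV_le {X : Type*} {Q : List X → (X → ℝ) → ℝ} {g : (ℕ → X) → EReal} {s : List X}
    {M : List X → ℝ} (h1 : IsSupermart Q M) (h2 : BddBelowProc M)
    (h3 : ∀ ω : ℕ → X, pref ω s.length = s →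
      g ω ≤ Filter.liminf (fun n => ((M (pref ω n) : ℝ) : EReal)) Filter.atTop) :
    EV Q g s ≤ M s := sInf_le ⟨M, h1, h2, h3, rfl⟩

theorem le_EV {X : Type*} [Fintype X] [Nonempty X]
    {Q : List X → (X → ℝ) → ℝ} (hQ : Coherent Q) 
    {g : (ℕ → X) → EReal} {c : ℝ} (hg : ∀ ω, (c : EReal) ≤ g ω) (s : List X) :
    (c : EReal) ≤ EV Q g s := by
  refine le_sInf ?_
  rintro y ⟨M, h1, h2, h3, rfl⟩
  have := lower_bound hQ h1 hg s h3 []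
  simp only [List.append_nil] at this
  exact_mod_cast this

theorem EV_mono {X : Type*} (Q : List X → (X → ℝ) → ℝ) {g h : (ℕ → X) → EReal}
    (H : ∀ ω, g ω ≤ h ω) (s : List X) : EV Q g s ≤ EV Q h s := by
  refine sInf_le_sInf ?_
  rintro y ⟨M, h1, h2, h3, rfl⟩
  exact ⟨M, h1, h2, fun ω hω => (H ω).trans (h3 ω hω), rfl⟩

theorem EV_supermart {X : Type*} [Fintype X] [Nonempty X]
    {Q : List X → (X → ℝ) → ℝ} (hQ : Coherent Q) {g : (ℕ → X) → EReal}
    (G : List X → ℝ) (hG : ∀ s, EV Q g s = G s) : IsSupermart Q G := by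
  intro s
  refine supermart_of_approx hQ s G fun ε hε => ?_
  have h : EV Q g s < ((G s + ε : ℝ) : EReal) := by
    rw [hG]; exact_mod_cast (by linarith : G s < G s + ε)
  obtain ⟨M, h1, h2, h3, h4⟩ := EV_exists h
  refine ⟨M, h1, fun x => ?_⟩
  have h5 : EV Q g (s ++ [x]) ≤ M (s ++ [x]) := EV_le h1 h2 fun ω hω => h3 ω (pref_through ω hω)
  rw [hG] at h5
  have h6 : G (s ++ [x]) ≤ M (s ++ [x]) := by exact_mod_cast h5
  simp only [pdiff]; linarith

/-- State of the buy-low-sell-high strategy. -/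
structure BuyState (X : Type*) where
  cur : List X
  wealth : ℝ
  hold : Option (List X → ℝ)
  cnt : ℕ

open Classical in
/-- One step of the strategy. -/
noncomputable def buyStep {X : Type*} (G : List X → ℝ) (P : List X → List X → ℝ) (a b : ℝ)
    (σ : BuyState X) (x : X) : BuyState X :=
  match σ.hold with
  | none => ⟨σ.cur ++ [x], σ.wealth,
      if G (σ.cur ++ [x]) < a then some (P (σ.cur ++ [x])) else none, σ.cnt⟩
  | some M => ⟨σ.cur ++ [x], σ.wealth + (M (σ.cur ++ [x]) - M σ.cur),
      if b < M (σ.cur ++ [x]) then none else some M,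
      if b < M (σ.cur ++ [x]) then σ.cnt + 1 else σ.cnt⟩

theorem levy_null {X : Type*} [Fintype X] [Nonempty X]
    {Q : List X → (X → ℝ) → ℝ} (hQ : Coherent Q) {g : (ℕ → X) → EReal}
    {c : ℝ} (hg : ∀ ω, (c : EReal) ≤ g ω)
    (G : List X → ℝ) (hG : ∀ s, EV Q g s = G s) (a b : ℝ) (hca : c < a) (hab : a < b) :
    NullSet Q {ω | (b : EReal) < g ω ∧ ∃ᶠ n in atTop, G (pref ω n) < a} := by
  classical
  have hP : ∀ s, ∃ M : List X → ℝ, G s < a → (IsSupermart Q M ∧ (∀ t, c ≤ M (s ++ t)) ∧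
    (∀ ω : ℕ → X, pref ω s.length = s →
      g ω ≤ Filter.liminf (fun n => ((M (pref ω n) : ℝ) : EReal)) Filter.atTop) ∧ M s = a) := by
    intro s
    by_cases hs : G s < a
    swap
    · exact ⟨fun _ => 0, fun h => absurd h hs⟩
    have h : EV Q g s < (a : EReal) := by rw [hG]; exact_mod_cast hs
    obtain ⟨M, h1, h2, h3, h4⟩ := EV_exists h
    have h5 : ∀ ω : ℕ → X, pref ω s.length = s →
      g ω ≤ Filter.liminf (fun n => (((fun t => M t + (a - M s)) (pref ω n) : ℝ) : EReal))
        Filter.atTop := by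
      intro ω hω
      refine (h3 ω hω).trans (liminf_le_liminf (Eventually.of_forall fun n => ?_))
      simp only
      exact_mod_cast (by linarith : M (pref ω n) ≤ M (pref ω n) + (a - M s))
    have h6 := supermart_add_const h1 (a - M s)
    exact ⟨fun t => M t + (a - M s), fun _ => ⟨h6, lower_bound hQ h6 hg s h5, h5, by ring⟩⟩
  choose P hP using hP
  let st : List X → BuyState X := fun s => s.foldl (buyStep G P a b) ⟨[], a - c, none, 0⟩
  have hst : ∀ s x, st (s ++ [x]) = buyStep G P a b (st s) x := by
    intro s x; simp [st]
  have hinv : ∀ s, (st s).cur = s ∧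
      ((st s).hold = none → a - c + (st s).cnt * (b - a) ≤ (st s).wealth) ∧
      (∀ M, (st s).hold = some M → (st s).cnt * (b - a) + M s - c ≤ (st s).wealth ∧
        IsSupermart Q M ∧ (∀ t, c ≤ M (s ++ t)) ∧
        (∀ ω : ℕ → X, pref ω s.length = s →
        g ω ≤ Filter.liminf (fun n => ((M (pref ω n) : ℝ) : EReal)) Filter.atTop)) := by
    intro s
    induction s using List.reverseRecOn with
    | nil => simp [st]
    | append_singleton s x ih =>
      obtain ⟨i1, i2, i3⟩ := ih
      rw [hst]
      rcases hh : (st s).hold with _ | M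
      · have j := i2 hh
        simp only [buyStep, hh, i1, true_and]
        refine ⟨fun _ => j, ?_⟩
        intro M hM
        split_ifs at hM with hlt
        obtain rfl := Option.some.inj hM
        obtain ⟨p1, p2, p3, p4⟩ := hP _ hlt
        exact ⟨by rw [p4]; linarith, p1, p2, p3⟩
      · obtain ⟨j1, j2, j3, j4⟩ := i3 M hh
        simp only [buyStep, hh, i1, true_and]
        constructor
        · intro hM
          split_ifs at hM ⊢ with hlt
          push_cast
          linarith
        · intro M' hM
          split_ifs at hM ⊢ with hlt
          obtain rfl := Option.some.inj hM
          refine ⟨by linarith, j2, fun t => ?_, fun ω hω => j4 ω (pref_through ω hω)⟩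
          have := j3 ([x] ++ t)
          simpa using this
  have hlow : ∀ s, (st s).cnt * (b - a) ≤ (st s).wealth := by
    intro s
    obtain ⟨i1, i2, i3⟩ := hinv s
    rcases hh : (st s).hold with _ | M
    · linarith [i2 hh]
    · obtain ⟨j1, j2, j3, j4⟩ := i3 M hh
      have := j3 []
      simp only [List.append_nil] at this
      linarith
  refine ⟨fun s => (st s).wealth, ?_, ?_, ?_⟩
  · intro s
    obtain ⟨i1, i2, i3⟩ := hinv s
    rcases hh : (st s).hold with _ | M
    · have : pdiff (fun s => (st s).wealth) s = 0 := by
        ext x; simp only [pdiff, hst]; simp [buyStep, hh]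
      rw [this, Q_zero hQ]
    · have : pdiff (fun s => (st s).wealth) s = pdiff M s := by
        ext x; simp only [pdiff, hst]; simp [buyStep, hh, i1]
      rw [this]; exact (i3 M hh).2.1 s
  · intro s
    refine le_trans ?_ (hlow s)
    have : 0 < b - a := by linarith
    positivity
  · rintro ω ⟨hb, hfr⟩
    let S : ℕ → BuyState X := fun n => st (pref ω n)
    have hS : ∀ n, S (n+1) = buyStep G P a b (S n) (ω n) := by
      intro n; simp only [S, pref_succ, hst]
    have hcur : ∀ n, (S n).cur ++ [ω n] = pref ω (n+1) := by
      intro n; simp only [S, (hinv _).1, pref_succ]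
    have hmon : Monotone fun n => (S n).cnt := by
      refine monotone_nat_of_le_succ fun n => ?_
      rw [hS]
      rcases hh : (S n).hold with _ | M
      · simp [buyStep, hh]
      · simp only [buyStep, hh]; split_ifs <;> omega
    have hnext : ∀ n, ∃ m, (S n).cnt + 1 ≤ (S m).cnt := by
      intro n
      by_contra! hc
      have hconst : ∀ m, n ≤ m → (S m).cnt = (S n).cnt := fun m hm =>
        le_antisymm (Nat.lt_succ_iff.1 (hc m)) (hmon hm)
      -- once holding, contradiction
      have hhold : ∀ m, n ≤ m → ∀ M, (S m).hold ≠ some M := by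
        intro m hm M hM
        have hkeep : ∀ k, m ≤ k → (S k).hold = some M := by
          intro k hk
          induction k, hk using Nat.le_induction with
          | base => exact hM
          | succ k hk ih =>
            have h1 := hconst (k+1) (by omega)
            rw [← hconst k (by omega), hS] at h1
            simp only [buyStep, ih] at h1
            rw [hS]
            simp only [buyStep, ih]
            split_ifs at h1 ⊢
            · omega
            · rfl
        have hle : ∀ k, m ≤ k → ¬ b < M (pref ω (k+1)) := by
          intro k hk hlt
          have h1 := hkeep (k+1) (by omega)
          rw [hS] at h1
          simp [buyStep, hkeep k hk, hcur, hlt] at h1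
        have h4 := ((hinv (pref ω m)).2.2 M hM).2.2.2 ω (by rw [pref_length])
        have h5 := eventually_lt_of_lt_liminf (hb.trans_le h4)
        obtain ⟨k, hk1, hk2⟩ := (h5.and (eventually_ge_atTop (m+1))).exists
        obtain ⟨k, rfl⟩ : ∃ j, k = j + 1 := ⟨k - 1, by omega⟩
        exact hle k (by omega) (by exact_mod_cast hk1)
      obtain ⟨k, hk1, hk2⟩ := (hfr.and_eventually (eventually_ge_atTop (n+1))).exists
      obtain ⟨k, rfl⟩ : ∃ j, k = j + 1 := ⟨k - 1, by omega⟩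
      rcases hh : (S k).hold with _ | M
      · refine hhold (k+1) (by omega) (P (pref ω (k+1))) ?_
        rw [hS]
        simp [buyStep, hh, hcur, hk1]
      · exact hhold k (by omega) M hh
    have hunb : ∀ K : ℕ, ∃ n, K ≤ (S n).cnt := by
      intro K
      induction K with
      | zero => exact ⟨0, Nat.zero_le _⟩
      | succ K ih =>
        obtain ⟨n, hn⟩ := ih
        obtain ⟨m, hm⟩ := hnext n
        exact ⟨m, by omega⟩
    have ht : Tendsto (fun n => (S n).cnt) atTop atTop := tendsto_atTop_atTop_of_monotone hmon hunb
    refine tendsto_atTop_mono (fun n => hlow (pref ω n)) ?_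
    exact (tendsto_natCast_atTop_atTop.comp ht).atTop_mul_const (by linarith)

theorem levy {X : Type*} [Fintype X] [Nonempty X]
    {Q : List X → (X → ℝ) → ℝ} (hQ : Coherent Q) {g : (ℕ → X) → EReal}
    {c : ℝ} (hg : ∀ ω, (c : EReal) ≤ g ω)
    (G : List X → ℝ) (hG : ∀ s, EV Q g s = G s) :
    ∃ N, NullSet Q N ∧ ∀ ω ∉ N,
      g ω ≤ Filter.liminf (fun n => ((G (pref ω n) : ℝ) : EReal)) Filter.atTop := by
  classical
  have hGc : ∀ s, c ≤ G s := by
    intro s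
    have := le_EV hQ hg s
    rw [hG] at this
    exact_mod_cast this
  obtain ⟨q, hq⟩ := exists_surjective_nat (ℚ × ℚ)
  let A : ℚ × ℚ → Set (ℕ → X) := fun p => {ω | c < (p.1 : ℝ) ∧ (p.1 : ℝ) < p.2 ∧
    (((p.2 : ℝ)) : EReal) < g ω ∧ ∃ᶠ n in atTop, G (pref ω n) < p.1}
  refine ⟨⋃ i, A (q i), null_union hQ _ fun i => ?_, ?_⟩
  · by_cases h1 : c < ((q i).1 : ℝ) ∧ ((q i).1 : ℝ) < (q i).2
    · have := levy_null hQ hg G hG _ _ h1.1 h1.2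
      obtain ⟨T, t1, t2, t3⟩ := this
      exact ⟨T, t1, t2, fun ω hω => t3 ω hω.2.2⟩
    · refine ⟨fun _ => 0, supermart_zero hQ, fun _ => le_rfl, fun ω hω => ?_⟩
      exact absurd ⟨hω.1, hω.2.1⟩ h1
  · intro ω hω
    by_contra! hc
    obtain ⟨b, hb1, hb2⟩ := EReal.lt_iff_exists_rat_btwn.1 hc
    obtain ⟨a, ha1, ha2⟩ := EReal.lt_iff_exists_rat_btwn.1 hb1
    apply hω
    obtain ⟨i, hi⟩ := hq (a, b)
    have hfr : ∃ᶠ n in atTop, G (pref ω n) < a :=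
      (frequently_lt_of_liminf_lt (by isBoundedDefault) ha1).mono fun n hn => by exact_mod_cast hn
    refine Set.mem_iUnion.2 ⟨i, ?_⟩
    rw [hi]
    obtain ⟨n, hn⟩ := hfr.exists
    exact ⟨(hGc _).trans_lt hn, by exact_mod_cast ha2, hb2, hfr⟩

theorem upward_convergence {X : Type*} [Fintype X] [Nonempty X]
    (Q : List X → (X → ℝ) → ℝ) (hQ : Coherent Q)
    (f : (ℕ → X) → EReal) (F : ℕ → (ℕ → X) → EReal)
    (hmono : ∀ n, F n ≤ F (n + 1))
    (hbdd : ∃ M : ℝ, ∀ n ω, (M : EReal) ≤ F n ω)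
    (hlim : ∀ ω, Filter.Tendsto (fun n => F n ω) Filter.atTop (nhds (f ω)))
    (hfin : EV Q f [] < ⊤) :
    Filter.Tendsto (fun n => EV Q (F n) []) Filter.atTop (nhds (EV Q f [])) := by
  obtain ⟨c, hc⟩ := hbdd
  have hM : Monotone F := monotone_nat_of_le_succ hmono
  have hFf : ∀ n ω, F n ω ≤ f ω := fun n ω =>
    Monotone.ge_of_tendsto (f := fun n => F n ω) (fun i j h => hM h ω) (hlim ω) n
  obtain ⟨y, ⟨M, h1, h2, h3, rfl⟩, h4⟩ := sInf_lt_iff.1 hfin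
  have hup : ∀ n s, EV Q (F n) s ≤ M s := fun n s =>
    EV_le h1 h2 fun ω _ => (hFf n ω).trans (h3 ω rfl)
  have hlo : ∀ n s, (c : EReal) ≤ EV Q (F n) s := fun n s => le_EV hQ (hc n) s
  let e : ℕ → List X → ℝ := fun n s => (EV Q (F n) s).toReal
  have he : ∀ n s, EV Q (F n) s = e n s := fun n s => by
    refine (EReal.coe_toReal ?_ ?_).symm
    · exact ((hup n s).trans_lt (EReal.coe_lt_top _)).ne
    · exact ((EReal.bot_lt_coe _).trans_le (hlo n s)).ne'
  have heM : ∀ n s, e n s ≤ M s := fun n s => by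
    have := hup n s; rw [he] at this; exact_mod_cast this
  have hec : ∀ n s, c ≤ e n s := fun n s => by
    have := hlo n s; rw [he] at this; exact_mod_cast this
  have hem : ∀ s, Monotone fun n => e n s := fun s i j hij => by
    have := EV_mono Q (hM hij) s
    rw [he, he] at this; exact_mod_cast this
  have hbd : ∀ s, BddAbove (Set.range fun n => e n s) := fun s =>
    ⟨M s, by rintro _ ⟨n, rfl⟩; exact heM n s⟩
  let L : List X → ℝ := fun s => ⨆ n, e n s
  have hL : ∀ s, Tendsto (fun n => e n s) atTop (nhds (L s)) := fun s =>
    tendsto_atTop_ciSup (hem s) (hbd s)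
  have heL : ∀ n s, e n s ≤ L s := fun n s => le_ciSup (hbd s) n
  have hLs : IsSupermart Q L := supermart_of_limit hQ L e (fun n => EV_supermart hQ _ (he n)) hL
  have hlevy := fun n => levy hQ (hc n) (e n) (he n)
  choose N hN hNl using hlevy
  obtain ⟨T, hT, hT0, hTl⟩ := null_union hQ N hN
  have key : ∀ ε : ℝ, 0 < ε → EV Q f [] ≤ ((L [] + ε * T [] : ℝ) : EReal) := by
    intro ε hε
    refine EV_le (M := fun s => L s + ε * T s) (supermart_add hQ hLs (supermart_mul hQ hT ε hε.le))
      ⟨c, fun s => ?_⟩ ?_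
    · have := hec 0 s
      have := heL 0 s
      have := mul_nonneg hε.le (hT0 s)
      linarith
    · intro ω _
      by_cases hω : ω ∈ ⋃ i, N i
      · have h5 : Tendsto (fun n => L (pref ω n) + ε * T (pref ω n)) atTop atTop := by
          refine tendsto_atTop_add_left_of_le _ c (fun n => (hec 0 _).trans (heL 0 _)) ?_
          exact (hTl ω hω).const_mul_atTop hε
        have h6 := (EReal.tendsto_coe_nhds_top_iff.2 h5).liminf_eq
        rw [h6]; exact le_top
      · refine le_of_tendsto' (hlim ω) fun n => ?_
        refine (hNl n ω fun h => hω (Set.mem_iUnion.2 ⟨n, h⟩)).trans ?_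
        refine liminf_le_liminf (Eventually.of_forall fun m => ?_)
        have := heL n (pref ω m)
        have := mul_nonneg hε.le (hT0 (pref ω m))
        exact_mod_cast (by linarith : e n (pref ω m) ≤ L (pref ω m) + ε * T (pref ω m))
  have hle : EV Q f [] ≤ (L [] : EReal) := by
    have h5 : Tendsto (fun ε : ℝ => ((L [] + ε * T [] : ℝ) : EReal)) (nhdsWithin 0 (Set.Ioi 0))
        (nhds ((L [] : ℝ) : EReal)) := by
      refine (continuous_coe_real_ereal.tendsto _).comp ?_
      have : Continuous fun ε : ℝ => L [] + ε * T [] := by fun_prop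
      have := (this.tendsto 0).mono_left (nhdsWithin_le_nhds (s := Set.Ioi 0))
      simpa using this
    exact ge_of_tendsto h5 (eventually_nhdsWithin_of_forall fun ε hε => key ε hε)
  have h7 : Tendsto (fun n => EV Q (F n) []) atTop (nhds ((L [] : ℝ) : EReal)) := by
    simp only [he]
    exact (continuous_coe_real_ereal.tendsto _).comp (hL [])
  have h8 : EV Q f [] = (L [] : EReal) :=
    le_antisymm hle (le_of_tendsto' h7 fun n => EV_mono Q (hFf n) [])
  rw [h8]; exact h7
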